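/- Let t ≥ 3, let D₁ and D₂ be additive extended perfect codes with α ≠ 0 and binary length α+2β = 2^t, and let C₁ = D₁^⊥ and C₂ = D₂^⊥ be their additive duals, both of type (α,β;γ̄,δ̄). Then ⟨C₁,C₂⟩ is an additive code of type (α,β;γ,δ;κ) for some γ, δ, κ satisfying: if δ̄ = 0, then δ = 0 and γ̄ ≤ κ = γ ≤ 2γ̄−1; if δ̄ = 1, then δ = 1 and γ̄ ≤ κ ≤ γ ≤ 2γ̄; if δ̄ > 1, then δ ∈ {δ̄, …, 2δ̄} and γ̄ ≤ κ ≤ γ ≤ 2γ̄+2δ̄−δ−1. -/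

import Mathlib

open scoped BigOperators

/-- `Z2` is the ring of integers modulo 2. -/
abbrev Z2 : Type := ZMod 2

/-- `Z4` is the ring of integers modulo 4. -/
abbrev Z4 : Type := ZMod 4

/-- The ambient group `Z₂^α × Z₄^β` for additive codes. -/
abbrev Amb (α β : ℕ) : Type := (Fin α → Z2) × (Fin β → Z4)

/-- The inner product on `Z₂^α × Z₄^β`:
`⟨u,v⟩ = 2·(Σᵢ ūᵢ·v̄ᵢ) + Σⱼ uⱼ·vⱼ ∈ Z₄`, where the bar denotes the lift `0 ↦ 0`, `1 ↦ 1`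
of binary coordinates into `Z₄`. -/
def addInner {α β : ℕ} (u v : Amb α β) : Z4 :=
  2 * (∑ i, ((u.1 i).val : Z4) * ((v.1 i).val : Z4)) + ∑ j, u.2 j * v.2 j

lemma addInner_zero_left {α β : ℕ} (v : Amb α β) : addInner 0 v = 0 := by
  simp [addInner]

lemma addInner_add_left {α β : ℕ} (u u' v : Amb α β) :
    addInner (u + u') v = addInner u v + addInner u' v := by
  have key : ∀ x x' y : Z2,
      (2 : Z4) * ((((x + x').val : ℕ) : Z4) * ((y.val : ℕ) : Z4)) =
        2 * (((x.val : ℕ) : Z4) * ((y.val : ℕ) : Z4)) +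
          2 * (((x'.val : ℕ) : Z4) * ((y.val : ℕ) : Z4)) := by decide
  simp only [addInner, Prod.fst_add, Prod.snd_add, Pi.add_apply, add_mul,
    Finset.mul_sum, Finset.sum_add_distrib]
  rw [Finset.sum_congr rfl (fun i _ => key (u.1 i) (u'.1 i) (v.1 i)),
    Finset.sum_add_distrib]
  ring

lemma addInner_neg_left {α β : ℕ} (u v : Amb α β) :
    addInner (-u) v = - addInner u v := by
  have hn : ∀ x : Z2, (-x) = x := by decide
  have key : ∀ S T : Z4, 2 * S + -T = -(2 * S + T) := by decide
  simp only [addInner, Prod.fst_neg, Prod.snd_neg, Pi.neg_apply, hn, neg_mul]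
  rw [Finset.sum_neg_distrib]
  exact key _ _

/-- The additive dual `C^⊥ = {u : ⟨u,v⟩ = 0 for all v ∈ C}` of an additive code `C`. -/
def dualCode {α β : ℕ} (C : AddSubgroup (Amb α β)) : AddSubgroup (Amb α β) where
  carrier := {u | ∀ v ∈ C, addInner u v = 0}
  zero_mem' := fun v _ => addInner_zero_left v
  add_mem' := by
    intro a b ha hb v hv
    rw [addInner_add_left, ha v hv, hb v hv, add_zero]
  neg_mem' := by
    intro a ha v hv
    rw [addInner_neg_left, ha v hv, neg_zero]

/-- An additive code `C ⊆ Z₂^α × Z₄^β` is of type `(α,β;γ,δ)` when it is isomorphic,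
as an abelian group, to `Z₂^γ × Z₄^δ`; equivalently (which is how we state it),
`|C| = 2^(γ+2δ)` and the number of elements `x ∈ C` with `x + x = 0` is `2^(γ+δ)`. -/
def isOfType {α β : ℕ} (C : AddSubgroup (Amb α β)) (γ δ : ℕ) : Prop :=
  Nat.card C = 2 ^ (γ + 2 * δ) ∧
    Nat.card {x : Amb α β // x ∈ C ∧ x + x = 0} = 2 ^ (γ + δ)

/-- An additive code `C` is of type `(α,β;γ,δ;κ)` when it is of type `(α,β;γ,δ)` and
`2^κ` is the cardinality of the image of `{x ∈ C : x + x = 0}` under the projection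
onto the binary coordinates. -/
def isOfTypeK {α β : ℕ} (C : AddSubgroup (Amb α β)) (γ δ κ : ℕ) : Prop :=
  isOfType C γ δ ∧
    Nat.card ↥(Prod.fst '' {x : Amb α β | x ∈ C ∧ x + x = 0}) = 2 ^ κ

/-- The Gray map on one quaternary coordinate:
`0 ↦ (0,0)`, `1 ↦ (0,1)`, `2 ↦ (1,1)`, `3 ↦ (1,0)`. -/
def grayPhi (y : Z4) : Z2 × Z2 :=
  if y = 0 then (0, 0) else if y = 1 then (0, 1) else if y = 2 then (1, 1) else (1, 0)

/-- The Gray map `Φ : Z₂^α × Z₄^β → Z₂^(α+2β)` (with index set `Fin α ⊕ Fin β × Fin 2`),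
acting as the identity on the binary coordinates and as `grayPhi` coordinatewise on the
quaternary coordinates. -/
def grayMap {α β : ℕ} (u : Amb α β) : (Fin α ⊕ Fin β × Fin 2) → Z2 :=
  Sum.elim (fun a => u.1 a)
    (fun b => if b.2 = 0 then (grayPhi (u.2 b.1)).1 else (grayPhi (u.2 b.1)).2)

/-- The minimum Hamming distance of a binary code `S` equals `d`. -/
def minDistEq {ι : Type} [Fintype ι] (S : Set (ι → Z2)) (d : ℕ) : Prop :=
  (∀ x ∈ S, ∀ y ∈ S, x ≠ y → d ≤ hammingDist x y) ∧
    ∃ x ∈ S, ∃ y ∈ S, x ≠ y ∧ hammingDist x y = d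

/-- A quaternary linear perfect code of length `β = 2^(t-1)` (`t ≥ 3`): an additive
subgroup of `Z₄^β` whose Gray image has cardinality `2^(2β-t-1)` and minimum Hamming
distance `4`. -/
def isQuatPerfect (t β : ℕ) (C : AddSubgroup (Amb 0 β)) : Prop :=
  3 ≤ t ∧ β = 2 ^ (t - 1) ∧
    Nat.card ↥(grayMap '' (C : Set (Amb 0 β))) = 2 ^ (2 * β - t - 1) ∧
    minDistEq (grayMap '' (C : Set (Amb 0 β))) 4

/-- An additive extended perfect code with `α ≠ 0` and binary length `α + 2β = 2^t`:
an additive subgroup of `Z₂^α × Z₄^β` with `α ≥ 1` whose Gray image has cardinality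
`2^(2^t - t - 1)` and minimum Hamming distance `4`. -/
def isAddExtPerfect (t α β : ℕ) (C : AddSubgroup (Amb α β)) : Prop :=
  1 ≤ α ∧ α + 2 * β = 2 ^ t ∧
    Nat.card ↥(grayMap '' (C : Set (Amb α β))) = 2 ^ (2 ^ t - t - 1) ∧
    minDistEq (grayMap '' (C : Set (Amb α β))) 4

/-! ### Finite abelian groups -/

/-- The elements of order at most two of a subgroup. -/
def twoTorsion {G : Type*} [AddCommGroup G] (C : AddSubgroup G) : AddSubgroup G where
  carrier := {x | x ∈ C ∧ x + x = 0}
  zero_mem' := ⟨C.zero_mem, add_zero 0⟩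
  add_mem' := fun {x y} hx hy => ⟨C.add_mem hx.1 hy.1, by
    rw [add_add_add_comm, hx.2, hy.2, add_zero]⟩
  neg_mem' := fun {x} hx => ⟨C.neg_mem hx.1, by rw [← neg_add, hx.2, neg_zero]⟩

/-- Doubling, as a homomorphism of an abelian group. -/
def doubling (G : Type*) [AddCommGroup G] : G →+ G where
  toFun x := x + x
  map_zero' := add_zero 0
  map_add' x y := add_add_add_comm x y x y

section Groups

variable {G H : Type*} [AddCommGroup G] [AddCommGroup H]

lemma doubling_apply (x : G) : doubling G x = x + x := rfl

lemma twoTorsion_eq_inf_ker (C : AddSubgroup G) : twoTorsion C = C ⊓ (doubling G).ker := rfl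

lemma card_map_mul_card_inf_ker [Finite G] (f : G →+ H) (C : AddSubgroup G) :
    Nat.card (C.map f) * Nat.card ↥(C ⊓ f.ker) = Nat.card C := by
  rw [← AddSubgroup.relIndex_ker, AddSubgroup.relIndex, inf_comm,
    ← Nat.card_congr (AddSubgroup.addSubgroupOfEquivOfLe
      (inf_le_right : f.ker ⊓ C ≤ C)).toEquiv,
    AddSubgroup.inf_addSubgroupOf_right, mul_comm]
  exact AddSubgroup.card_mul_index _

lemma card_twoTorsion_mul_card_map_doubling [Finite G] (C : AddSubgroup G) :
    Nat.card (twoTorsion C) * Nat.card (C.map (doubling G)) = Nat.card C := by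
  rw [twoTorsion_eq_inf_ker, mul_comm, card_map_mul_card_inf_ker]

lemma card_sup_mul_card_inf [Finite G] (A B : AddSubgroup G) :
    Nat.card ↥(A ⊔ B) * Nat.card ↥(A ⊓ B) = Nat.card A * Nat.card B := by
  have h1 := card_map_mul_card_inf_ker (QuotientAddGroup.mk' B) (A ⊔ B)
  have h2 := card_map_mul_card_inf_ker (QuotientAddGroup.mk' B) A
  have h3 : (A ⊔ B).map (QuotientAddGroup.mk' B) = A.map (QuotientAddGroup.mk' B) := by
    rw [AddSubgroup.map_sup, QuotientAddGroup.map_mk'_self, sup_bot_eq]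
  rw [QuotientAddGroup.ker_mk'] at h1 h2
  rw [inf_eq_right.2 (le_sup_right : B ≤ A ⊔ B), h3] at h1
  rw [← h1, ← h2]
  ring

lemma card_le_card_of_le [Finite G] {A B : AddSubgroup G} (h : A ≤ B) :
    Nat.card A ≤ Nat.card B :=
  Nat.le_of_dvd Nat.card_pos (AddSubgroup.card_dvd_of_le h)

lemma two_mul_card_le_card_of_lt [Finite G] {A B : AddSubgroup G} (h : A < B) :
    2 * Nat.card A ≤ Nat.card B := by
  obtain ⟨k, hk⟩ := AddSubgroup.card_dvd_of_le h.le
  have hk2 : 2 ≤ k := by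
    by_contra! hlt
    interval_cases k
    · exact Nat.card_pos.ne' (by simpa using hk)
    · exact h.ne (AddSubgroup.eq_of_le_of_card_ge h.le (by simp [hk]))
  rw [hk, mul_comm]
  exact Nat.mul_le_mul_left _ hk2

lemma card_map_mul_card_map_doubling_le [Finite G] (f : G →+ H) {C : AddSubgroup G}
    (h : C.map (doubling G) ≤ twoTorsion C ⊓ f.ker) :
    Nat.card ((twoTorsion C).map f) * Nat.card (C.map (doubling G)) ≤
      Nat.card (twoTorsion C) := by
  rw [← card_map_mul_card_inf_ker f (twoTorsion C)]
  exact Nat.mul_le_mul_left _ (card_le_card_of_le h)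

/-- If the intersection of `A` and `B` contains an element outside the intersection of their
doubles, then the two-torsion of `A + B` is at most half of the product of the two-torsions. -/
lemma two_mul_card_twoTorsion_sup_le [Finite G] {A B : AddSubgroup G}
    (h : A.map (doubling G) ⊓ B.map (doubling G) < A ⊓ B) :
    2 * Nat.card (twoTorsion (A ⊔ B)) ≤
      Nat.card (twoTorsion A) * Nat.card (twoTorsion B) := by
  have hC := card_twoTorsion_mul_card_map_doubling (A ⊔ B)
  have hA := card_twoTorsion_mul_card_map_doubling A
  have hB := card_twoTorsion_mul_card_map_doubling B
  have hs := card_sup_mul_card_inf A B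
  have hd := card_sup_mul_card_inf (A.map (doubling G)) (B.map (doubling G))
  rw [← AddSubgroup.map_sup] at hd
  have hi := two_mul_card_le_card_of_lt h
  have p1 : 0 < Nat.card ((A ⊔ B).map (doubling G)) := Nat.card_pos
  have p2 : 0 < Nat.card ↥(A.map (doubling G) ⊓ B.map (doubling G)) := Nat.card_pos
  generalize Nat.card ↥(A.map (doubling G) ⊓ B.map (doubling G)) = m at *
  generalize Nat.card ↥((A ⊔ B).map (doubling G)) = d at *
  generalize Nat.card ↥(A ⊓ B) = k at *
  rw [← hA, ← hB, ← hC] at hs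
  refine Nat.le_of_mul_le_mul_left ?_ (Nat.mul_pos p1 p2)
  calc d * m * (2 * Nat.card (twoTorsion (A ⊔ B)))
      = Nat.card (twoTorsion (A ⊔ B)) * d * (2 * m) := by ring
    _ ≤ Nat.card (twoTorsion (A ⊔ B)) * d * k := Nat.mul_le_mul_left _ hi
    _ = Nat.card (twoTorsion A) * Nat.card (twoTorsion B) *
        (Nat.card (A.map (doubling G)) * Nat.card (B.map (doubling G))) := by rw [hs]; ring
    _ = d * m * (Nat.card (twoTorsion A) * Nat.card (twoTorsion B)) := by rw [← hd]; ring

lemma exists_card_eq_two_pow {n : ℕ}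
    (hn : Nat.card G = 2 ^ n) (C : AddSubgroup G) : ∃ k, Nat.card C = 2 ^ k := by
  have h := AddSubgroup.card_addSubgroup_dvd_card C
  rw [hn] at h
  obtain ⟨k, -, hk⟩ := (Nat.dvd_prime_pow Nat.prime_two).1 h
  exact ⟨k, hk⟩

end Groups

lemma hasEnoughRootsOfUnity_multiplicative_zmod (n : ℕ) [NeZero n] :
    HasEnoughRootsOfUnity (Multiplicative (ZMod n)) n where
  prim := ⟨Multiplicative.ofAdd 1, by
    have h := IsPrimitiveRoot.orderOf (Multiplicative.ofAdd (1 : ZMod n))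
    rwa [orderOf_ofAdd_eq_addOrderOf, ZMod.addOrderOf_one] at h⟩
  cyc := by
    have : IsCyclic (Multiplicative (ZMod n))ˣ :=
      isCyclic_of_surjective (toUnits : Multiplicative (ZMod n) ≃* _)
        (toUnits : Multiplicative (ZMod n) ≃* _).surjective
    infer_instance

/-- In an abelian group of exponent dividing `n`, a subgroup is cut out by the
`ZMod n`-valued homomorphisms vanishing on it. -/
lemma mem_of_forall_addMonoidHom_zmod {G : Type*} [AddCommGroup G] [Finite G] {n : ℕ} [NeZero n]
    (hn : ∀ x : G, n • x = 0) (H : AddSubgroup G) {x : G}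
    (h : ∀ f : G →+ ZMod n, (∀ y ∈ H, f y = 0) → f x = 0) : x ∈ H := by
  have := hasEnoughRootsOfUnity_multiplicative_zmod n
  have hexp : Monoid.exponent (Multiplicative G) ∣ n :=
    Monoid.exponent_dvd_of_forall_pow_eq_one fun g => hn g.toAdd
  have := HasEnoughRootsOfUnity.of_dvd (Multiplicative (ZMod n)) hexp
  refine (CommGroup.forall_monoidHom_apply_eq_one_iff (Multiplicative (ZMod n))
    (AddSubgroup.toSubgroup H) (Multiplicative.ofAdd x)).1 fun φ hφ => ?_
  let ψ : Multiplicative G →* Multiplicative (ZMod n) := toUnits.symm.toMonoidHom.comp φ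
  have hψ : ∀ y, ψ y = 1 ↔ φ y = 1 := fun y => by simp [ψ]
  exact (hψ _).1 (h (AddMonoidHom.toMultiplicative.symm ψ) fun y hy => (hψ _).2 (hφ _ hy))

/-! ### Duality for additive codes -/

section Codes

variable {α β : ℕ}

/-- The vectors of weight one of `Z₂^α × Z₄^β`. -/
def unitVec : Fin α ⊕ Fin β × Bool → Amb α β
  | Sum.inl i => (Pi.single i 1, 0)
  | Sum.inr (j, b) => (0, Pi.single j (if b then -1 else 1))

lemma neg_unitVec (a : Fin α ⊕ Fin β × Bool) : ∃ b, unitVec b = -unitVec a := by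
  rcases a with i | ⟨j, b⟩
  · refine ⟨Sum.inl i, Prod.ext ?_ (by simp [unitVec])⟩
    rw [Prod.fst_neg, unitVec, ← Pi.single_neg]
    rfl
  · refine ⟨Sum.inr (j, !b), Prod.ext (by simp [unitVec]) ?_⟩
    cases b <;> simp [unitVec, ← Pi.single_neg]

lemma inl_add_self (i : Fin α) :
    (unitVec (Sum.inl i) : Amb α β) + unitVec (Sum.inl i) = 0 := by
  refine Prod.ext ?_ (by simp [unitVec])
  rw [Prod.fst_add, unitVec, ← Pi.single_add]
  exact Pi.single_zero i

lemma unitVec_injective : Function.Injective (unitVec : Fin α ⊕ Fin β × Bool → Amb α β) := by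
  have h1 : (1 : Z2) ≠ 0 := by decide
  have h2 : ∀ b : Bool, (if b then -1 else 1 : Z4) ≠ 0 := by decide
  have h3 : ∀ b c : Bool, (if b then -1 else 1 : Z4) = (if c then -1 else 1) → b = c := by decide
  rintro (i | ⟨j, b⟩) (i' | ⟨j', b'⟩) h <;> rw [Prod.ext_iff] at h
  · by_contra hne
    have := congrFun h.1 i
    simp only [unitVec, Pi.single_eq_same,
      Pi.single_eq_of_ne (fun hh : i = i' => hne (congrArg _ hh))] at this
    exact h1 this
  · exact absurd (by simpa [unitVec] using congrFun h.1 i) h1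
  · exact absurd (by simpa [unitVec] using (congrFun h.1 i').symm) h1
  · by_cases hj : j = j'
    · subst hj
      rw [h3 b b' (by simpa [unitVec] using congrFun h.2 j)]
    · have := congrFun h.2 j
      simp only [unitVec, Pi.single_eq_same, Pi.single_eq_of_ne hj] at this
      exact absurd this (h2 b)

lemma closure_range_unitVec :
    AddSubmonoid.closure (Set.range (unitVec : Fin α ⊕ Fin β × Bool → Amb α β)) = ⊤ := by
  refine eq_top_iff.2 fun u _ => ?_
  have hu : u = ∑ i, (u.1 i).val • unitVec (Sum.inl i) +
      ∑ j, (u.2 j).val • unitVec (Sum.inr (j, false)) := by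
    refine Prod.ext ?_ ?_
    · rw [Prod.fst_add, Prod.fst_sum, Prod.fst_sum]
      ext i
      simp [unitVec, Finset.sum_apply, Pi.single_apply, -ZMod.natCast_val, ZMod.natCast_zmod_val]
    · rw [Prod.snd_add, Prod.snd_sum, Prod.snd_sum]
      ext j
      simp [unitVec, Finset.sum_apply, Pi.single_apply, -ZMod.natCast_val, ZMod.natCast_zmod_val]
  rw [hu]
  exact add_mem
    (sum_mem fun i _ => nsmul_mem (AddSubmonoid.subset_closure (Set.mem_range_self _)) _)
    (sum_mem fun j _ => nsmul_mem (AddSubmonoid.subset_closure (Set.mem_range_self _)) _)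

lemma card_amb : Nat.card (Amb α β) = 2 ^ (α + 2 * β) := by
  rw [pow_add, pow_mul]
  simp [Nat.card_eq_fintype_card, ZMod.card]

lemma addInner_comm (u v : Amb α β) : addInner u v = addInner v u := by
  simp only [addInner, mul_comm]

/-- Pairing with a fixed vector, as a homomorphism. -/
def innerHom (v : Amb α β) : Amb α β →+ Z4 where
  toFun u := addInner u v
  map_zero' := addInner_zero_left v
  map_add' u u' := addInner_add_left u u' v

lemma innerHom_apply (u v : Amb α β) : innerHom v u = addInner u v := rfl

lemma addInner_inl (i : Fin α) (v : Amb α β) :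
    addInner (unitVec (Sum.inl i)) v = 2 * ((v.1 i).val : Z4) := by
  have h : ∀ k, (((Pi.single i 1 : Fin α → Z2) k).val : Z4) * ((v.1 k).val : Z4) =
      if k = i then ((v.1 i).val : Z4) else 0 := by
    intro k
    by_cases hk : k = i
    · subst hk
      simp [ZMod.val_one]
    · simp [hk]
  simp only [addInner, unitVec, h]
  simp

lemma addInner_inr (j : Fin β) (b : Bool) (v : Amb α β) :
    addInner (unitVec (Sum.inr (j, b))) v = (if b then -1 else 1) * v.2 j := by
  simp [addInner, unitVec, Pi.single_apply]

lemma exists_eq_innerHom (f : Amb α β →+ Z4) : ∃ v, f = innerHom v := by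
  have h2 : ∀ x : Z4, x + x = 0 →
      x = 2 * ((((if x = 0 then 0 else 1 : Z2)).val : ℕ) : Z4) := by decide
  refine ⟨(fun i => if f (unitVec (Sum.inl i)) = 0 then 0 else 1,
    fun j => f (unitVec (Sum.inr (j, false)))), ?_⟩
  refine AddMonoidHom.eq_of_eqOn_denseM closure_range_unitVec ?_
  rintro _ ⟨i | ⟨j, b⟩, rfl⟩
  · rw [innerHom_apply, addInner_inl]
    refine h2 _ ?_
    rw [← map_add, inl_add_self, map_zero]
  · rw [innerHom_apply, addInner_inr]
    cases b
    · simp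
    · have : (unitVec (Sum.inr (j, true)) : Amb α β) = -unitVec (Sum.inr (j, false)) := by
        simp [unitVec, Pi.single_neg]
      simp [this]

lemma mem_dualCode {C : AddSubgroup (Amb α β)} {u : Amb α β} :
    u ∈ dualCode C ↔ ∀ v ∈ C, addInner u v = 0 := Iff.rfl

lemma four_nsmul_eq_zero (u : Amb α β) : 4 • u = 0 := by
  have h1 : ∀ x : Z2, 4 • x = 0 := by decide
  have h2 : ∀ x : Z4, 4 • x = 0 := by decide
  exact Prod.ext (funext fun i => h1 (u.1 i)) (funext fun j => h2 (u.2 j))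

/-- The double dual of an additive code is the code. -/
lemma mem_of_mem_dualCode_dualCode {C : AddSubgroup (Amb α β)} {u : Amb α β}
    (hu : u ∈ dualCode (dualCode C)) : u ∈ C := by
  refine mem_of_forall_addMonoidHom_zmod four_nsmul_eq_zero C fun f hf => ?_
  obtain ⟨v, rfl⟩ := exists_eq_innerHom f
  exact hu v fun y hy => (addInner_comm v y).trans (hf y hy)

/-! ### The weight induced by the Gray map -/

/-- The Lee weight on `Z₄`. -/
def leeWt (y : Z4) : ℕ :=
  (if (grayPhi y).1 = 0 then 0 else 1) + (if (grayPhi y).2 = 0 then 0 else 1)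

/-- The weight on `Z₂^α × Z₄^β` corresponding to the Hamming weight under the Gray map. -/
def addWt (u : Amb α β) : ℕ :=
  ∑ i, (if u.1 i = 0 then 0 else 1) + ∑ j, leeWt (u.2 j)

lemma hammingDist_grayMap_zero (u : Amb α β) :
    hammingDist (grayMap u) (grayMap 0) = addWt u := by
  have h0 : ∀ k, grayMap (0 : Amb α β) k = 0 := by
    rintro (i | ⟨j, k⟩) <;> simp [grayMap, grayPhi]
  rw [hammingDist, Finset.card_filter]
  simp only [h0, Fintype.sum_sum_type, Fintype.sum_prod_type, Fin.sum_univ_two, addWt, leeWt,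
    ne_eq, ite_not]
  simp only [grayMap, Sum.elim_inl, Sum.elim_inr, if_true, one_ne_zero, if_false]
  refine congrArg₂ _ (Finset.sum_congr rfl fun i _ => if_congr Iff.rfl rfl rfl)
    (Finset.sum_congr rfl fun j _ => ?_)
  exact congrArg₂ _ (if_congr Iff.rfl rfl rfl) (if_congr Iff.rfl rfl rfl)

lemma grayMap_injective : Function.Injective (grayMap : Amb α β → _) := by
  have h : ∀ x y : Z4, (grayPhi x).1 = (grayPhi y).1 → (grayPhi x).2 = (grayPhi y).2 → x = y := by
    decide
  intro u v huv
  refine Prod.ext (funext fun i => congrFun huv (Sum.inl i)) (funext fun j => h _ _ ?_ ?_)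
  · simpa [grayMap] using congrFun huv (Sum.inr (j, 0))
  · simpa [grayMap] using congrFun huv (Sum.inr (j, 1))

lemma addWt_add_le (u v : Amb α β) : addWt (u + v) ≤ addWt u + addWt v := by
  have h1 : ∀ x y : Z2, (if x + y = 0 then 0 else 1 : ℕ) ≤
      (if x = 0 then 0 else 1) + (if y = 0 then 0 else 1) := by decide
  have h2 : ∀ x y : Z4, leeWt (x + y) ≤ leeWt x + leeWt y := by decide
  have e1 := Finset.sum_le_sum fun i (_ : i ∈ Finset.univ) => h1 (u.1 i) (v.1 i)
  have e2 := Finset.sum_le_sum fun j (_ : j ∈ Finset.univ) => h2 (u.2 j) (v.2 j)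
  rw [Finset.sum_add_distrib] at e1 e2
  simp only [addWt, Prod.fst_add, Prod.snd_add, Pi.add_apply]
  omega

lemma addWt_unitVec (a : Fin α ⊕ Fin β × Bool) : addWt (unitVec a : Amb α β) = 1 := by
  have h0 : leeWt 0 = 0 := by decide
  have h1 : ∀ b : Bool, leeWt (if b then -1 else 1) = 1 := by decide
  rcases a with i | ⟨j, b⟩
  · simp [addWt, unitVec, h0, Pi.single_apply]
  · have h : ∀ k, leeWt ((Pi.single j (if b then -1 else 1) : Fin β → Z4) k) =
        if k = j then 1 else 0 := by
      intro k
      by_cases hk : k = j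
      · subst hk
        simp only [Pi.single_eq_same, h1, if_true]
      · simp [hk, h0]
    simp only [addWt, unitVec, h]
    simp

/-- The vector with all binary coordinates `1` and all quaternary coordinates `2`. -/
def parityVec (α β : ℕ) : Amb α β := (fun _ => 1, fun _ => 2)

lemma addInner_unitVec_parityVec (a : Fin α ⊕ Fin β × Bool) :
    addInner (unitVec a) (parityVec α β) = 2 := by
  rcases a with i | ⟨j, b⟩
  · rw [addInner_inl, parityVec, ZMod.val_one]
    rfl
  · rw [addInner_inr]
    exact (by decide : ∀ b : Bool, (if b then -1 else 1 : Z4) * 2 = 2) b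

/-! ### Additive extended perfect codes -/

variable {t : ℕ} {D : AddSubgroup (Amb α β)}

lemma four_le_addWt (hD : isAddExtPerfect t α β D) {u : Amb α β} (hu : u ∈ D) (h0 : u ≠ 0) :
    4 ≤ addWt u := by
  rw [← hammingDist_grayMap_zero]
  exact hD.2.2.2.1 _ ⟨u, hu, rfl⟩ _ ⟨0, D.zero_mem, rfl⟩ (grayMap_injective.ne h0)

lemma card_quotient (hD : isAddExtPerfect t α β D) : Nat.card (Amb α β ⧸ D) = 2 ^ (t + 1) := by
  have hlt : t < 2 ^ t := Nat.lt_two_pow_self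
  have hc : Nat.card D = 2 ^ (2 ^ t - t - 1) := by
    rw [← hD.2.2.1, Nat.card_image_of_injective grayMap_injective]
    rfl
  have ha : Nat.card (Amb α β) = 2 ^ (t + 1) * 2 ^ (2 ^ t - t - 1) := by
    rw [card_amb, ← pow_add, hD.2.1]
    congr 1
    omega
  rw [AddSubgroup.card_eq_card_quotient_mul_card_addSubgroup D, hc] at ha
  exact Nat.eq_of_mul_eq_mul_right (by positivity) ha

lemma unitVec_not_mem (hD : isAddExtPerfect t α β D) (a : Fin α ⊕ Fin β × Bool) :
    unitVec a ∉ D := by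
  intro h
  have hw := addWt_unitVec a
  have hi := addInner_unitVec_parityVec a
  have := four_le_addWt hD h (fun h0 => by
    rw [h0, addInner_zero_left] at hi
    exact absurd hi (by decide))
  omega

lemma add_unitVec_not_mem (hD : isAddExtPerfect t α β D) {a b : Fin α ⊕ Fin β × Bool}
    (hne : (unitVec a : Amb α β) + unitVec b ≠ 0) : unitVec a + unitVec b ∉ D := by
  intro h
  have h4 := four_le_addWt hD h hne
  have h2 := addWt_add_le (unitVec a : Amb α β) (unitVec b)
  rw [addWt_unitVec, addWt_unitVec] at h2
  omega

lemma add_add_unitVec_not_mem (hD : isAddExtPerfect t α β D) (a b c : Fin α ⊕ Fin β × Bool) :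
    unitVec a + unitVec b + unitVec c ∉ D := by
  intro h
  have h4 := four_le_addWt hD h (fun h0 => by
    have h1 := addInner_zero_left (parityVec α β)
    rw [← h0, addInner_add_left, addInner_add_left, addInner_unitVec_parityVec,
      addInner_unitVec_parityVec, addInner_unitVec_parityVec] at h1
    exact absurd h1 (by decide))
  have h2 := addWt_add_le (unitVec a + unitVec b : Amb α β) (unitVec c)
  have h3 := addWt_add_le (unitVec a : Amb α β) (unitVec b)
  rw [addWt_unitVec] at h2 h3
  rw [addWt_unitVec] at h3
  omega

lemma eq_of_unitVec_sub_mem (hD : isAddExtPerfect t α β D) {a b : Fin α ⊕ Fin β × Bool}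
    (h : unitVec a - unitVec b ∈ D) : a = b := by
  obtain ⟨c, hc⟩ := neg_unitVec b
  by_contra hne
  rw [sub_eq_add_neg, ← hc] at h
  refine add_unitVec_not_mem hD (fun h0 => hne (unitVec_injective ?_)) h
  rwa [hc, ← sub_eq_add_neg, sub_eq_zero] at h0

/-- The cosets of the weight-one vectors and their translates by one of them cover everything. -/
lemma exists_sub_unitVec_mem (hD : isAddExtPerfect t α β D) (c : Fin α ⊕ Fin β × Bool)
    (u : Amb α β) : ∃ a, u - unitVec a ∈ D ∨ u - unitVec a - unitVec c ∈ D := by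
  let s : (Fin α ⊕ Fin β × Bool) ⊕ (Fin α ⊕ Fin β × Bool) → Amb α β :=
    Sum.elim unitVec (fun a => unitVec a + unitVec c)
  have hinj : Function.Injective fun x => (s x : Amb α β ⧸ D) := by
    have hmix : ∀ a b : Fin α ⊕ Fin β × Bool, -unitVec a + (unitVec b + unitVec c) ∉ D := by
      intro a b h
      obtain ⟨d, hd⟩ := neg_unitVec a
      rw [← hd, ← add_assoc] at h
      exact add_add_unitVec_not_mem hD _ _ _ h
    rintro (a | a) (b | b) h <;> replace h := QuotientAddGroup.eq.1 h <;>
      simp only [s, Sum.elim_inl, Sum.elim_inr] at h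
    · rw [neg_add_eq_sub] at h
      rw [eq_of_unitVec_sub_mem hD h]
    · exact absurd h (hmix _ _)
    · exact absurd (D.neg_mem h) (by simpa [add_comm] using hmix b a)
    · rw [neg_add_eq_sub, add_sub_add_right_eq_sub] at h
      rw [eq_of_unitVec_sub_mem hD h]
  have hcard : Nat.card (Amb α β ⧸ D) ≤
      Nat.card ((Fin α ⊕ Fin β × Bool) ⊕ (Fin α ⊕ Fin β × Bool)) := by
    rw [card_quotient hD, pow_succ, ← hD.2.1]
    simp
    omega
  obtain ⟨x, hx⟩ := (hinj.bijective_of_nat_card_le hcard).2 (u : Amb α β ⧸ D)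
  replace hx := QuotientAddGroup.eq.1 hx
  rcases x with a | a <;> simp only [s, Sum.elim_inl, Sum.elim_inr] at hx
  · exact ⟨a, Or.inl (by rwa [neg_add_eq_sub] at hx)⟩
  · exact ⟨a, Or.inr (by rwa [neg_add_eq_sub, ← sub_sub] at hx)⟩

/-- Every codeword has even weight. -/
lemma parityVec_mem_dualCode (hD : isAddExtPerfect t α β D) : parityVec α β ∈ dualCode D := by
  have key : ∀ u : Amb α β,
      (addInner u (parityVec α β) = 0 ∧ ∀ a, u - unitVec a ∉ D) ∨
      (addInner u (parityVec α β) = 2 ∧ ∃ a, u - unitVec a ∈ D) := by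
    intro u
    have hu : u ∈ AddSubmonoid.closure (Set.range (unitVec : Fin α ⊕ Fin β × Bool → Amb α β)) := by
      rw [closure_range_unitVec]
      trivial
    induction hu using AddSubmonoid.closure_induction_right with
    | zero =>
      refine Or.inl ⟨addInner_zero_left _, fun a h => unitVec_not_mem hD a ?_⟩
      simpa using h
    | add_right u _ y hy ih =>
      obtain ⟨c, rfl⟩ := hy
      obtain ⟨d, hd⟩ := neg_unitVec c
      rcases ih with ⟨hp, hs⟩ | ⟨hp, b, hb⟩
      · refine Or.inr ⟨by rw [addInner_add_left, hp, addInner_unitVec_parityVec]; rfl, ?_⟩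
        obtain ⟨a, ha | ha⟩ := exists_sub_unitVec_mem hD d u
        · exact absurd ha (hs a)
        · refine ⟨a, ?_⟩
          rwa [hd, sub_neg_eq_add, sub_add_eq_add_sub] at ha
      · refine Or.inl ⟨by rw [addInner_add_left, hp, addInner_unitVec_parityVec]; rfl, ?_⟩
        intro a ha
        obtain ⟨e, he⟩ := neg_unitVec a
        refine add_add_unitVec_not_mem hD b c e ?_
        have := D.sub_mem ha hb
        rw [he]
        convert this using 1
        abel
  rw [mem_dualCode]
  intro d hd
  rw [addInner_comm]
  rcases key d with ⟨h, -⟩ | ⟨-, a, ha⟩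
  · exact h
  · exact absurd (by simpa using D.sub_mem hd ha) (unitVec_not_mem hD a)

lemma inr_add_self_ne_zero (j : Fin β) (b : Bool) :
    (unitVec (Sum.inr (j, b)) : Amb α β) + unitVec (Sum.inr (j, b)) ≠ 0 := by
  intro h
  have h1 := congrFun (congrArg Prod.snd h) j
  simp only [unitVec, Prod.snd_add, Pi.add_apply, Pi.single_eq_same] at h1
  exact (by decide : ∀ b : Bool, (if b then -1 else 1 : Z4) + (if b then -1 else 1) ≠ 0) b h1

lemma exists_inl_of_add_self_mem (hD : isAddExtPerfect t α β D) {a : Fin α ⊕ Fin β × Bool}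
    (h : (unitVec a : Amb α β) + unitVec a ∈ D) : ∃ i, a = Sum.inl i := by
  rcases a with i | ⟨j, b⟩
  · exact ⟨i, rfl⟩
  · exact absurd h (add_unitVec_not_mem hD (inr_add_self_ne_zero j b))

/-- A two-torsion element of the dual with zero binary part is the double of a dual element. -/
lemma twoTorsion_inf_ker_fst_le (hD : isAddExtPerfect t α β D) :
    twoTorsion (dualCode D) ⊓ (AddMonoidHom.fst (Fin α → Z2) (Fin β → Z4)).ker ≤
      (dualCode D).map (doubling _) := by
  rintro c ⟨⟨hc, -⟩, hc0 : c.1 = 0⟩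
  refine mem_of_mem_dualCode_dualCode fun u hu => ?_
  have hinl : ∀ i, addInner (unitVec (Sum.inl i)) c = 0 := fun i => by
    rw [addInner_inl, hc0]
    simp
  have huu : u + u ∈ D := by
    refine mem_of_mem_dualCode_dualCode fun v hv => ?_
    have := hu (v + v) ⟨v, hv, rfl⟩
    rwa [addInner_comm, addInner_add_left, addInner_comm, ← addInner_add_left] at this
  have hzero : ∀ d ∈ D, innerHom c d = 0 := fun d hd => (addInner_comm d c).trans (hc d hd)
  have hinl' : ∀ a, unitVec a + unitVec a ∈ D → innerHom c (unitVec a) = 0 := fun a ha => by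
    obtain ⟨i, rfl⟩ := exists_inl_of_add_self_mem hD ha
    exact hinl i
  have i₀ : Fin α := ⟨0, hD.1⟩
  rw [addInner_comm, ← innerHom_apply]
  obtain ⟨a, ha | ha⟩ := exists_sub_unitVec_mem hD (Sum.inl i₀) u
  · have h1 := hinl' a (by
      have := D.sub_mem huu (D.add_mem ha ha)
      convert this using 1
      abel)
    have h2 := hzero _ ha
    rwa [map_sub, h1, sub_zero] at h2
  · have h1 := hinl' a (by
      have := D.sub_mem huu (D.add_mem ha ha)
      rw [← add_zero (unitVec a + unitVec a), ← inl_add_self i₀]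
      convert this using 1
      abel)
    have h2 := hzero _ ha
    rwa [map_sub, map_sub, h1, innerHom_apply _ c, innerHom_apply _ c, hinl, sub_zero,
      sub_zero] at h2

/-- Some codeword of the dual has a unit in any given quaternary coordinate. -/
lemma exists_add_self_ne_zero (hD : isAddExtPerfect t α β D) (j : Fin β) :
    ∃ v ∈ dualCode D, (v + v).2 j ≠ 0 := by
  by_contra! h
  refine add_unitVec_not_mem hD (inr_add_self_ne_zero j false)
    (mem_of_mem_dualCode_dualCode fun v hv => ?_)
  rw [addInner_add_left, addInner_inr]
  simpa using h v hv

/-- The doubles have zero binary part and order at most two. -/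
lemma map_doubling_le (C : AddSubgroup (Amb α β)) :
    C.map (doubling _) ≤ twoTorsion C ⊓ (AddMonoidHom.fst (Fin α → Z2) (Fin β → Z4)).ker := by
  rintro _ ⟨v, hv, rfl⟩
  have h1 : ∀ x : Z2, x + x = 0 := by decide
  refine ⟨⟨C.add_mem hv hv, ?_⟩, funext fun i => h1 (v.1 i)⟩
  have := four_nsmul_eq_zero v
  rw [doubling_apply, ← this]
  abel

lemma map_doubling_inf_lt {D₁ D₂ : AddSubgroup (Amb α β)}
    (hD₁ : isAddExtPerfect t α β D₁) (hD₂ : isAddExtPerfect t α β D₂) :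
    (dualCode D₁).map (doubling _) ⊓ (dualCode D₂).map (doubling _) <
      dualCode D₁ ⊓ dualCode D₂ := by
  refine lt_of_le_of_ne (inf_le_inf (fun x hx => (map_doubling_le _ hx).1.1)
    (fun x hx => (map_doubling_le _ hx).1.1)) fun h => ?_
  have hp : parityVec α β ∈ dualCode D₁ ⊓ dualCode D₂ :=
    ⟨parityVec_mem_dualCode hD₁, parityVec_mem_dualCode hD₂⟩
  rw [← h] at hp
  have h0 := congrFun (show (parityVec α β).1 = 0 from (map_doubling_le _ hp.1).2) ⟨0, hD₁.1⟩
  exact absurd h0 (by decide : (1 : Z2) ≠ 0)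

/-- If the doubles of the dual form a group of order two, it is generated by the vector with
zero binary coordinates and all quaternary coordinates `2`. -/
lemma map_doubling_eq_zmultiples (hD : isAddExtPerfect t α β D)
    (hcard : Nat.card ((dualCode D).map (doubling _)) = 2) :
    (dualCode D).map (doubling _) = AddSubgroup.zmultiples (0, fun _ => 2) := by
  have h2 : ∀ y : Z4, y + y ≠ 0 → y + y = 2 := by decide
  obtain ⟨w, hw0, hw⟩ := (Nat.card_eq_two_iff' (0 : (dualCode D).map (doubling _))).1 hcard
  have hall : ∀ x ∈ (dualCode D).map (doubling _), x ≠ 0 → x = w := fun x hx hx0 =>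
    congrArg Subtype.val (hw ⟨x, hx⟩ fun h => hx0 (congrArg Subtype.val h))
  have hwv : w.1 = (0, fun _ => 2) := by
    refine Prod.ext (map_doubling_le _ w.2).2 (funext fun j => ?_)
    obtain ⟨v, hv, hvj⟩ := exists_add_self_ne_zero hD j
    rw [← hall (v + v) ⟨v, hv, rfl⟩ fun h => hvj (by rw [h]; rfl)]
    exact h2 _ hvj
  rw [← hwv]
  refine le_antisymm (fun x hx => ?_) ((AddSubgroup.zmultiples_le).2 w.2)
  by_cases h0 : x = 0
  · exact h0 ▸ AddSubgroup.zero_mem _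
  · exact hall x hx h0 ▸ AddSubgroup.mem_zmultiples _

lemma isOfType_iff {C : AddSubgroup (Amb α β)} {γ δ : ℕ} :
    isOfType C γ δ ↔ Nat.card (twoTorsion C) = 2 ^ (γ + δ) ∧
      Nat.card (C.map (doubling _)) = 2 ^ δ := by
  have h := card_twoTorsion_mul_card_map_doubling C
  have ht : Nat.card {x : Amb α β // x ∈ C ∧ x + x = 0} = Nat.card (twoTorsion C) := rfl
  rw [isOfType, ht, ← h, show γ + 2 * δ = γ + δ + δ by ring, pow_add 2 (γ + δ)]
  constructor
  · rintro ⟨h1, h2⟩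
    rw [h2] at h1
    exact ⟨h2, Nat.eq_of_mul_eq_mul_left (by positivity) h1⟩
  · rintro ⟨h1, h2⟩
    exact ⟨by rw [h1, h2], h1⟩

end Codes

/-- bounds on the type of the span of the duals of two additive extended
perfect codes with `α ≠ 0` (the bound `γ ≤ 2γ̄-1`, resp. `γ ≤ 2γ̄+2δ̄-δ-1`, is stated
in the subtraction-free equivalent form `γ+1 ≤ 2γ̄`, resp. `γ+δ+1 ≤ 2γ̄+2δ̄`). -/
theorem stmt13 {t α β γb δb : ℕ} (ht : 3 ≤ t)
    (D₁ D₂ : AddSubgroup (Amb α β))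
    (hD₁ : isAddExtPerfect t α β D₁) (hD₂ : isAddExtPerfect t α β D₂)
    (h₁ : isOfType (dualCode D₁) γb δb) (h₂ : isOfType (dualCode D₂) γb δb) :
    ∃ γ δ κ : ℕ, isOfTypeK (dualCode D₁ ⊔ dualCode D₂) γ δ κ ∧
      (δb = 0 → δ = 0 ∧ γb ≤ κ ∧ κ = γ ∧ γ + 1 ≤ 2 * γb) ∧
      (δb = 1 → δ = 1 ∧ γb ≤ κ ∧ κ ≤ γ ∧ γ ≤ 2 * γb) ∧
      (1 < δb → (δb ≤ δ ∧ δ ≤ 2 * δb) ∧ γb ≤ κ ∧ κ ≤ γ ∧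
        γ + δ + 1 ≤ 2 * γb + 2 * δb) := by
  obtain ⟨ht₁, hd₁⟩ := isOfType_iff.1 h₁
  obtain ⟨ht₂, hd₂⟩ := isOfType_iff.1 h₂
  obtain ⟨a, ha⟩ := exists_card_eq_two_pow card_amb (twoTorsion (dualCode D₁ ⊔ dualCode D₂))
  obtain ⟨δ, hδ⟩ :=
    exists_card_eq_two_pow card_amb ((dualCode D₁ ⊔ dualCode D₂).map (doubling _))
  obtain ⟨κ, hκ⟩ := exists_card_eq_two_pow (n := α) (by simp [Nat.card_eq_fintype_card, ZMod.card])
    ((twoTorsion (dualCode D₁ ⊔ dualCode D₂)).map (AddMonoidHom.fst (Fin α → Z2) (Fin β → Z4)))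
  have hκδ : κ + δ ≤ a := by
    have h := card_map_mul_card_map_doubling_le _ (map_doubling_le (dualCode D₁ ⊔ dualCode D₂))
    rwa [hκ, hδ, ha, ← pow_add, Nat.pow_le_pow_iff_right one_lt_two] at h
  have hbound : a + 1 ≤ 2 * γb + 2 * δb := by
    have h := two_mul_card_twoTorsion_sup_le (map_doubling_inf_lt hD₁ hD₂)
    rw [ha, ht₁, ht₂, ← pow_succ', ← pow_add, Nat.pow_le_pow_iff_right one_lt_two] at h
    omega
  have hδ₁ : δb ≤ δ := by
    have h := card_le_card_of_le (AddSubgroup.map_mono (f := doubling _)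
      (le_sup_left : dualCode D₁ ≤ dualCode D₁ ⊔ dualCode D₂))
    rwa [hd₁, hδ, Nat.pow_le_pow_iff_right one_lt_two] at h
  have hδ₂ : δ ≤ 2 * δb := by
    have h := card_sup_mul_card_inf ((dualCode D₁).map (doubling _))
      ((dualCode D₂).map (doubling _))
    rw [← AddSubgroup.map_sup, hδ, hd₁, hd₂, ← pow_add] at h
    have := (Nat.pow_le_pow_iff_right one_lt_two).1 (Nat.le_of_dvd (by positivity) ⟨_, h.symm⟩)
    omega
  have hγκ : γb ≤ κ := by
    have h := card_map_mul_card_inf_ker (AddMonoidHom.fst (Fin α → Z2) (Fin β → Z4))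
      (twoTorsion (dualCode D₁))
    have hker := card_le_card_of_le (twoTorsion_inf_ker_fst_le hD₁)
    have hle : twoTorsion (dualCode D₁) ≤ twoTorsion (dualCode D₁ ⊔ dualCode D₂) :=
      fun x hx => ⟨(le_sup_left : dualCode D₁ ≤ dualCode D₁ ⊔ dualCode D₂) hx.1, hx.2⟩
    have hmono := card_le_card_of_le (AddSubgroup.map_mono
      (f := AddMonoidHom.fst (Fin α → Z2) (Fin β → Z4)) hle)
    rw [hκ] at hmono
    rw [hd₁] at hker
    have := Nat.mul_le_mul hmono hker
    rw [h, ht₁, ← pow_add, Nat.pow_le_pow_iff_right one_lt_two] at this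
    omega
  have hδone : δb = 1 → δ = 1 := by
    rintro rfl
    rw [AddSubgroup.map_sup, map_doubling_eq_zmultiples hD₁ (by simpa using hd₁),
      ← map_doubling_eq_zmultiples hD₂ (by simpa using hd₂), sup_idem, hd₂] at hδ
    exact (Nat.pow_right_injective le_rfl hδ).symm
  have hκzero : δb = 0 → κ = a := by
    rintro rfl
    have hbot : (dualCode D₁).map (doubling _) = ⊥ := AddSubgroup.card_eq_one.1 hd₁
    have hempty : IsEmpty (Fin β) := ⟨fun j => by
      obtain ⟨v, hv, hvj⟩ := exists_add_self_ne_zero hD₁ j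
      have : v + v ∈ (dualCode D₁).map (doubling _) := ⟨v, hv, rfl⟩
      rw [hbot, AddSubgroup.mem_bot] at this
      exact hvj (by rw [this]; rfl)⟩
    have hinj : Function.Injective (AddMonoidHom.fst (Fin α → Z2) (Fin β → Z4)) :=
      fun x y h => Prod.ext h (Subsingleton.elim _ _)
    rw [AddSubgroup.card_map_of_injective hinj, ha] at hκ
    exact (Nat.pow_right_injective le_rfl hκ).symm
  refine ⟨a - δ, δ, κ, ⟨isOfType_iff.2 ⟨by rw [ha]; congr 1; omega, hδ⟩, hκ⟩, ?_, ?_, ?_⟩ <;>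
    omega
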